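/- Let G be a countable amenable group, 𝒜 a finite set, 𝒞 : G → 𝒜 a coloring, and let (U_j) be a Følner sequence in G along which the frequency ν_P = lim_j #_P(𝒞|_{U_j})/|U_j| exists for every pattern P. Let (X, ‖·‖) be a Banach space and let F : 𝔽(G) → X be almost additive (with some boundary term b) and 𝒞-invariant. Then there exists an element F̄ ∈ X such that lim_{j→∞} ‖ F̄ − F(U_j)/|U_j| ‖ = 0. -/

import Mathlib

open Set Filter

/-- The `K`-boundary of a set `T` in a group `G`. -/
def kBoundary {G : Type*} [Group G] (K T : Set G) : Set G :=
  {g : G | ((fun k => k * g) '' K ∩ T).Nonempty ∧ ((fun k => k * g) '' K ∩ Tᶜ).Nonempty}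

/-- A Følner sequence of finite subsets of a countable group. -/
def IsFolnerF {G : Type*} [Group G] (U : ℕ → Finset G) : Prop :=
  (∀ n, (U n).Nonempty) ∧
    ∀ K : Finset G, K.Nonempty →
      Tendsto (fun n => ((kBoundary (K : Set G) ((U n : Set G))).ncard : ℝ) / ((U n).card : ℝ))
        atTop (nhds 0)

/-- The number of occurrences of the pattern `P : D(P) → 𝒜` in the coloring `C` restricted
to `Q`: the number of `x ∈ G` with `D(P)·x ⊆ Q` and `C(y x) = P(y)` for all `y ∈ D(P)`. -/
noncomputable def patternCount {G : Type*} [Group G] {A : Type*} (C : G → A)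
    (Dp : Finset G) (P : G → A) (Q : Finset G) : ℕ :=
  Set.ncard {x : G | (∀ y ∈ Dp, y * x ∈ Q) ∧ ∀ y ∈ Dp, C (y * x) = P y}

/-- The number of points of `Q` which left multiplication by `k` moves out of `Q`. -/
def cutCard {G : Type*} [Group G] [DecidableEq G] (k : G) (Q : Finset G) : ℕ :=
  (Q.filter fun x => k * x ∉ Q).card

theorem finite_kBoundary {G : Type*} [Group G] (K Q : Finset G) :
    (kBoundary (K : Set G) (Q : Set G)).Finite := by
  classical
  refine (Finset.finite_toSet (Finset.image₂ (fun k x => k⁻¹ * x) K Q)).subset ?_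
  rintro g ⟨⟨_, ⟨k, hk, rfl⟩, hx⟩, -⟩
  rw [Finset.mem_coe, Finset.mem_image₂]
  exact ⟨k, hk, k * g, hx, by group⟩

theorem cutCard_le_ncard_kBoundary {G : Type*} [Group G] [DecidableEq G] (k : G)
    (Q : Finset G) :
    cutCard k Q ≤ (kBoundary (({1, k} : Finset G) : Set G) (Q : Set G)).ncard := by
  rw [cutCard, ← Set.ncard_coe_finset]
  refine Set.ncard_le_ncard ?_ (finite_kBoundary _ _)
  intro x hx
  simp only [Finset.coe_filter, Set.mem_ofPred_eq] at hx
  exact ⟨⟨x, ⟨1, by simp, by simp⟩, hx.1⟩, ⟨k * x, ⟨k, by simp, rfl⟩, hx.2⟩⟩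

theorem ncard_kBoundary_le_sum_cutCard {G : Type*} [Group G] [DecidableEq G]
    (K Q : Finset G) :
    (kBoundary (K : Set G) (Q : Set G)).ncard ≤
      ∑ k ∈ K, ∑ k' ∈ K, cutCard (k' * k⁻¹) Q := by
  have h : kBoundary (K : Set G) (Q : Set G) ⊆
      ((K.biUnion fun k => K.biUnion fun k' =>
        (Q.filter fun x => k' * k⁻¹ * x ∉ Q).image fun x => k⁻¹ * x : Finset G) : Set G) := by
    rintro g ⟨⟨_, ⟨k, hk, rfl⟩, hx⟩, ⟨_, ⟨k', hk', rfl⟩, hx'⟩⟩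
    simp only [Finset.mem_coe, Finset.mem_biUnion, Finset.mem_image, Finset.mem_filter]
    exact ⟨k, hk, k', hk', k * g, ⟨hx, by simpa [mul_assoc] using hx'⟩, by group⟩
  refine (Set.ncard_le_ncard h (Finset.finite_toSet _)).trans ?_
  rw [Set.ncard_coe_finset]
  refine Finset.card_biUnion_le.trans (Finset.sum_le_sum fun k _ => ?_)
  exact Finset.card_biUnion_le.trans (Finset.sum_le_sum fun k' _ => Finset.card_image_le)

theorem IsFolnerF.tendsto_cutCard {G : Type*} [Group G] [DecidableEq G] {U : ℕ → Finset G}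
    (hU : IsFolnerF U) (k : G) :
    Tendsto (fun n => (cutCard k (U n) : ℝ) / ((U n).card : ℝ)) atTop (nhds 0) := by
  refine squeeze_zero (fun n => by positivity) (fun n => ?_) (hU.2 {1, k} (by simp))
  gcongr
  exact cutCard_le_ncard_kBoundary k (U n)

theorem isFolnerF_of_tendsto_cutCard {G : Type*} [Group G] [DecidableEq G] {U : ℕ → Finset G}
    (hne : ∀ n, (U n).Nonempty)
    (h : ∀ k, Tendsto (fun n => (cutCard k (U n) : ℝ) / ((U n).card : ℝ)) atTop (nhds 0)) :
    IsFolnerF U := by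
  refine ⟨hne, fun K _ => ?_⟩
  have hsum : Tendsto (fun n => ∑ k ∈ K, ∑ k' ∈ K,
      (cutCard (k' * k⁻¹) (U n) : ℝ) / ((U n).card : ℝ)) atTop (nhds 0) := by
    simpa using tendsto_finsetSum K fun k _ => tendsto_finsetSum K fun k' _ => h (k' * k⁻¹)
  refine squeeze_zero (fun n => by positivity) (fun n => ?_) hsum
  simp_rw [← Finset.sum_div]
  gcongr
  exact_mod_cast ncard_kBoundary_le_sum_cutCard K (U n)

/-- A boundary term is dominated by an arbitrarily small multiple of the volume plus a multiple
of finitely many cut cardinalities. -/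
theorem exists_le_add_sum_cutCard {G : Type*} [Group G] [Countable G] [DecidableEq G]
    (b : Finset G → ℝ) (D : ℝ)
    (hbfol : ∀ V : ℕ → Finset G, IsFolnerF V →
      Tendsto (fun j => b (V j) / ((V j).card : ℝ)) atTop (nhds 0))
    (hbD : ∀ Q : Finset G, b Q ≤ D * (Q.card : ℝ)) {ε : ℝ} (hε : 0 < ε) :
    ∃ (K : Finset G) (M : ℝ), 0 ≤ M ∧
      ∀ Q : Finset G, b Q ≤ ε * Q.card + M * ∑ k ∈ K, (cutCard k Q : ℝ) := by
  by_contra! H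
  obtain ⟨e, he⟩ := exists_surjective_nat G
  choose Q hQ using fun n : ℕ => H ((Finset.range n).image e) (n : ℝ) n.cast_nonneg
  have hne : ∀ n, (Q n).Nonempty := by
    intro n
    by_contra hn
    rw [Finset.not_nonempty_iff_eq_empty] at hn
    have h1 := hQ n
    have h2 := hbD (Q n)
    simp [hn, cutCard] at h1 h2
    linarith
  have hpos : ∀ n, (0 : ℝ) < (Q n).card := fun n => by exact_mod_cast (hne n).card_pos
  have hF : IsFolnerF Q := by
    refine isFolnerF_of_tendsto_cutCard hne fun k => ?_
    obtain ⟨m, rfl⟩ := he k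
    refine squeeze_zero' (Eventually.of_forall fun n => by positivity) ?_
      (tendsto_const_div_atTop_nhds_zero_nat D)
    filter_upwards [eventually_gt_atTop m] with n hn
    have hn0 : (0 : ℝ) < n := by exact_mod_cast (Nat.zero_le m).trans_lt hn
    have h1 : (cutCard (e m) (Q n) : ℝ) ≤
        ∑ k ∈ (Finset.range n).image e, (cutCard k (Q n) : ℝ) :=
      Finset.single_le_sum (f := fun k => (cutCard k (Q n) : ℝ)) (fun _ _ => by positivity)
        (Finset.mem_image_of_mem e (Finset.mem_range.2 hn))
    rw [div_le_div_iff₀ (hpos n) hn0]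
    have h2 := hQ n
    have h3 := hbD (Q n)
    have h4 := mul_le_mul_of_nonneg_left h1 hn0.le
    have h5 := mul_pos hε (hpos n)
    linarith
  have hlt := (hbfol Q hF).eventually (gt_mem_nhds hε)
  obtain ⟨n, hn⟩ := hlt.exists
  rw [div_lt_iff₀ (hpos n)] at hn
  have h2 := hQ n
  have : 0 ≤ (n : ℝ) * ∑ k ∈ (Finset.range n).image e, (cutCard k (Q n) : ℝ) := by positivity
  linarith

/-- The element `c` has the smallest label among the elements of `E`. -/
def IsFirst {G : Type*} (l : G → ℕ) (E : Finset G) (c : G) : Prop :=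
  c ∈ E ∧ ∀ c' ∈ E, l c ≤ l c'

theorem IsFirst.unique {G : Type*} {l : G → ℕ} (hl : Function.Injective l) {E : Finset G}
    {c c' : G} (h : IsFirst l E c) (h' : IsFirst l E c') : c = c' :=
  hl (le_antisymm (h.2 _ h'.1) (h'.2 _ h.1))

theorem exists_isFirst {G : Type*} (l : G → ℕ) {E : Finset G} (hE : E.Nonempty) :
    ∃ c, IsFirst l E c := by
  obtain ⟨c, hc, h⟩ := E.exists_min_image l hE
  exact ⟨c, hc, h⟩

theorem IsFirst.mono {G : Type*} {l : G → ℕ} {E E' : Finset G} {c : G} (h : IsFirst l E c)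
    (hc : c ∈ E') (hE : E' ⊆ E) : IsFirst l E' c :=
  ⟨hc, fun c' hc' => h.2 c' (hE hc')⟩

theorem isFirst_comp_iff {G : Type*} [DecidableEq G] {l : G → ℕ} {π : G → G}
    (hπ : Function.Injective π) {E : Finset G} {c : G} :
    IsFirst (l ∘ π) E c ↔ IsFirst l (E.image π) (π c) := by
  simp [IsFirst, hπ.eq_iff]

/-- The labelling of `G` induced by a permutation of the finite set `W`. -/
def permLabel {G : Type*} [DecidableEq G] (e : G → ℕ) (W : Finset G)
    (σ : Equiv.Perm {x // x ∈ W}) : G → ℕ :=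
  e ∘ Equiv.Perm.ofSubtype σ

theorem permLabel_injective {G : Type*} [DecidableEq G] {e : G → ℕ}
    (he : Function.Injective e) (W : Finset G) (σ : Equiv.Perm {x // x ∈ W}) :
    Function.Injective (permLabel e W σ) :=
  he.comp (Equiv.injective _)

theorem permLabel_mul {G : Type*} [DecidableEq G] (e : G → ℕ) (W : Finset G)
    (σ π : Equiv.Perm {x // x ∈ W}) :
    permLabel e W (σ * π) = permLabel e W σ ∘ Equiv.Perm.ofSubtype π := by
  simp [permLabel, Function.comp_assoc]

open Classical in
/-- In a uniformly random order every element of `E` is equally likely to come first. -/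
theorem card_isFirst_mul_card {G : Type*} [DecidableEq G] {e : G → ℕ}
    (he : Function.Injective e) {W E : Finset G} (hE : E ⊆ W) {a : G} (ha : a ∈ E) :
    (Finset.univ.filter fun σ : Equiv.Perm {x // x ∈ W} =>
      IsFirst (permLabel e W σ) E a).card * E.card =
      Fintype.card (Equiv.Perm {x // x ∈ W}) := by
  have hconst : ∀ a' ∈ E, (Finset.univ.filter fun σ : Equiv.Perm {x // x ∈ W} =>
      IsFirst (permLabel e W σ) E a').card = (Finset.univ.filter
        fun σ : Equiv.Perm {x // x ∈ W} => IsFirst (permLabel e W σ) E a).card := by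
    intro a' ha'
    let π : Equiv.Perm {x // x ∈ W} := Equiv.swap ⟨a, hE ha⟩ ⟨a', hE ha'⟩
    have hπ : (Equiv.Perm.ofSubtype π : Equiv.Perm G) = Equiv.swap a a' :=
      Equiv.Perm.ofSubtype_swap_eq _ _
    have himg : E.image (Equiv.Perm.ofSubtype π : Equiv.Perm G) = E := by
      refine Finset.eq_of_subset_of_card_le ?_ ?_
      · intro y hy
        obtain ⟨x, hx, rfl⟩ := Finset.mem_image.1 hy
        rw [hπ, Equiv.swap_apply_def]
        split_ifs <;> assumption
      · rw [Finset.card_image_of_injective _ (Equiv.injective _)]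
    refine Finset.card_equiv (Equiv.mulRight π) fun σ => ?_
    simp only [Finset.mem_filter, Finset.mem_univ, true_and, Equiv.coe_mulRight]
    rw [permLabel_mul, isFirst_comp_iff (Equiv.injective _), himg, hπ, Equiv.swap_apply_left]
  have hsum : ∑ a' ∈ E, (Finset.univ.filter fun σ : Equiv.Perm {x // x ∈ W} =>
      IsFirst (permLabel e W σ) E a').card = Fintype.card (Equiv.Perm {x // x ∈ W}) := by
    rw [← Finset.card_biUnion, ← Finset.card_univ]
    · congr 1
      ext σ
      obtain ⟨c, hc⟩ := exists_isFirst (permLabel e W σ) ⟨a, ha⟩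
      simpa using ⟨c, hc.1, hc⟩
    · intro x _ y _ hxy
      refine Finset.disjoint_filter.2 ?_
      exact fun σ _ h h' => hxy (h.unique (permLabel_injective he W σ) h')
  rw [← hsum, Finset.sum_congr rfl hconst, Finset.sum_const, smul_eq_mul, mul_comm]

open Classical in
/-- In a random order, two sets with small symmetric difference are unlikely to have different
first elements. -/
theorem card_not_common_isFirst_mul_card_le {G : Type*} [DecidableEq G] {e : G → ℕ}
    (he : Function.Injective e) {W A B : Finset G} (hA : A ⊆ W) (hB : B ⊆ W)
    (hcard : A.card = B.card) :
    (Finset.univ.filter fun σ : Equiv.Perm {x // x ∈ W} =>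
      ¬ ∃ c, IsFirst (permLabel e W σ) A c ∧ IsFirst (permLabel e W σ) B c).card * A.card ≤
      Fintype.card (Equiv.Perm {x // x ∈ W}) * (2 * (A \ B).card) := by
  rcases A.eq_empty_or_nonempty with rfl | hAne
  · simp
  set s : G → Finset (Equiv.Perm {x // x ∈ W}) := fun a =>
    Finset.univ.filter fun σ => IsFirst (permLabel e W σ) (A ∪ B) a
  have hsub : (Finset.univ.filter fun σ : Equiv.Perm {x // x ∈ W} =>
      ¬ ∃ c, IsFirst (permLabel e W σ) A c ∧ IsFirst (permLabel e W σ) B c) ⊆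
      ((A \ B) ∪ (B \ A)).biUnion s := by
    intro σ hσ
    obtain ⟨c, hc⟩ := exists_isFirst (permLabel e W σ)
      (hAne.mono (Finset.subset_union_left (s₂ := B)))
    simp only [Finset.mem_filter, Finset.mem_univ, true_and, not_exists, not_and] at hσ
    simp only [Finset.mem_biUnion, s, Finset.mem_filter, Finset.mem_univ, true_and]
    refine ⟨c, ?_, hc⟩
    have hnot : c ∈ A → c ∉ B := fun h h' =>
      hσ c (hc.mono h Finset.subset_union_left) (hc.mono h' Finset.subset_union_right)
    have := Finset.mem_union.1 hc.1
    simp only [Finset.mem_union, Finset.mem_sdiff]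
    tauto
  have hdiff : ((A \ B) ∪ (B \ A)).card ≤ 2 * (A \ B).card := by
    refine (Finset.card_union_le _ _).trans ?_
    rw [Finset.card_sdiff_comm hcard.symm]
    omega
  calc _ ≤ (∑ a ∈ (A \ B) ∪ (B \ A), (s a).card) * (A ∪ B).card :=
        Nat.mul_le_mul ((Finset.card_le_card hsub).trans Finset.card_biUnion_le)
          (Finset.card_le_card Finset.subset_union_left)
    _ = ∑ a ∈ (A \ B) ∪ (B \ A), Fintype.card (Equiv.Perm {x // x ∈ W}) := by
        rw [Finset.sum_mul]
        refine Finset.sum_congr rfl fun a ha => ?_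
        refine card_isFirst_mul_card he (Finset.union_subset hA hB) ?_
        exact Finset.union_subset_union Finset.sdiff_subset Finset.sdiff_subset ha
    _ ≤ _ := by
        rw [Finset.sum_const, smul_eq_mul, mul_comm]
        exact Nat.mul_le_mul_left _ hdiff

/-- The elements `c` for which the translate `T c` contains `x`. -/
def centers {G : Type*} [Group G] [DecidableEq G] (T : Finset G) (x : G) : Finset G :=
  T.image fun t => t⁻¹ * x

theorem mem_centers {G : Type*} [Group G] [DecidableEq G] {T : Finset G} {x c : G} :
    c ∈ centers T x ↔ x * c⁻¹ ∈ T := by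
  constructor
  · intro h
    obtain ⟨t, ht, rfl⟩ := Finset.mem_image.1 h
    simpa using ht
  · exact fun h => Finset.mem_image.2 ⟨_, h, by group⟩

theorem card_centers {G : Type*} [Group G] [DecidableEq G] (T : Finset G) (x : G) :
    (centers T x).card = T.card :=
  Finset.card_image_of_injective _ fun a b h => by simpa using h

theorem card_centers_sdiff {G : Type*} [Group G] [DecidableEq G] (T : Finset G) (k x : G) :
    (centers T x \ centers T (k * x)).card = cutCard k T := by
  have : centers T x \ centers T (k * x) =
      (T.filter fun t => k * t ∉ T).image fun t => t⁻¹ * x := by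
    ext c
    simp only [Finset.mem_sdiff, mem_centers, Finset.mem_image, Finset.mem_filter]
    constructor
    · exact fun h => ⟨x * c⁻¹, by simpa [mul_assoc] using h, by group⟩
    · rintro ⟨t, ht, rfl⟩
      simpa [mul_assoc] using ht
  rw [this, cutCard]
  exact Finset.card_image_of_injective _ fun a b h => by simpa using h

open Classical in
/-- The points of `U` for which `c` is the first element among the centers of the translates
of `T` containing them. -/
noncomputable def cell {G : Type*} [Group G] [DecidableEq G] (l : G → ℕ) (T U : Finset G)
    (c : G) : Finset G :=
  U.filter fun x => IsFirst l (centers T x) c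

theorem mem_cell {G : Type*} [Group G] [DecidableEq G] {l : G → ℕ} {T U : Finset G}
    {c x : G} : x ∈ cell l T U c ↔ x ∈ U ∧ IsFirst l (centers T x) c := by
  simp [cell]

theorem disjoint_cell {G : Type*} [Group G] [DecidableEq G] {l : G → ℕ}
    (hl : Function.Injective l) (T U : Finset G) {c c' : G} (h : c ≠ c') :
    Disjoint (cell l T U c) (cell l T U c') := by
  rw [Finset.disjoint_left]
  exact fun x hx hx' => h ((mem_cell.1 hx).2.unique hl (mem_cell.1 hx').2)

theorem biUnion_cell {G : Type*} [Group G] [DecidableEq G] (l : G → ℕ) {T U W : Finset G}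
    (hT : T.Nonempty) (hW : ∀ x ∈ U, centers T x ⊆ W) :
    W.biUnion (cell l T U) = U := by
  ext x
  simp only [Finset.mem_biUnion, mem_cell]
  refine ⟨fun ⟨_, _, h, _⟩ => h, fun h => ?_⟩
  obtain ⟨c, hc⟩ := exists_isFirst l (hT.image fun t => t⁻¹ * x)
  exact ⟨c, hW x h hc.1, h, hc⟩

open Classical in
theorem sum_cutCard_cell_le {G : Type*} [Group G] [DecidableEq G] {l : G → ℕ}
    (hl : Function.Injective l) (T U W : Finset G) (k : G) :
    ∑ c ∈ W, cutCard k (cell l T U c) ≤ cutCard k U + (U.filter fun x =>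
      ¬ ∃ c, IsFirst l (centers T x) c ∧ IsFirst l (centers T (k * x)) c).card := by
  unfold cutCard
  rw [← Finset.card_biUnion]
  · refine (Finset.card_le_card ?_).trans (Finset.card_union_le _ _)
    intro x hx
    simp only [Finset.mem_biUnion, Finset.mem_filter, mem_cell] at hx
    obtain ⟨c, -, ⟨hxU, hxc⟩, hk⟩ := hx
    simp only [Finset.mem_union, Finset.mem_filter]
    by_cases hkU : k * x ∈ U
    · refine Or.inr ⟨hxU, ?_⟩
      rintro ⟨c', h, h'⟩
      obtain rfl := hxc.unique hl h
      exact hk ⟨hkU, h'⟩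
    · exact Or.inl ⟨hxU, hkU⟩
  · intro c _ c' _ h
    exact (disjoint_cell hl T U h).mono (Finset.filter_subset _ _) (Finset.filter_subset _ _)

theorem sum_card_cell_le_sum_cutCard {G : Type*} [Group G] [DecidableEq G] {l : G → ℕ}
    (hl : Function.Injective l) (T U W : Finset G) :
    ∑ c ∈ W with ¬ ∀ t ∈ T, t * c ∈ U, (cell l T U c).card ≤
      ∑ t ∈ T, ∑ t' ∈ T, cutCard (t' * t⁻¹) U := by
  rw [← Finset.card_biUnion fun c _ c' _ h => disjoint_cell hl T U h]
  have h : (W.filter fun c => ¬ ∀ t ∈ T, t * c ∈ U).biUnion (cell l T U) ⊆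
      T.biUnion fun t => T.biUnion fun t' => U.filter fun x => t' * t⁻¹ * x ∉ U := by
    intro x hx
    simp only [Finset.mem_biUnion, Finset.mem_filter, mem_cell, not_forall] at hx
    obtain ⟨c, ⟨-, t', ht', htc⟩, hxU, hxc⟩ := hx
    simp only [Finset.mem_biUnion, Finset.mem_filter]
    exact ⟨x * c⁻¹, mem_centers.1 hxc.1, t', ht', hxU, by simpa [mul_assoc] using htc⟩
  refine (Finset.card_le_card h).trans ?_
  refine Finset.card_biUnion_le.trans (Finset.sum_le_sum fun t _ => ?_)
  exact Finset.card_biUnion_le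

open Classical in
/-- The cell of `c` in the whole group, translated back into `T`. -/
noncomputable def shape {G : Type*} [Group G] [DecidableEq G] (l : G → ℕ) (T : Finset G)
    (c : G) : Finset G :=
  T.filter fun t => IsFirst l (centers T (t * c)) c

theorem cell_eq_image_shape {G : Type*} [Group G] [DecidableEq G] (l : G → ℕ)
    {T U : Finset G} {c : G} (hc : ∀ t ∈ T, t * c ∈ U) :
    cell l T U c = (shape l T c).image fun g => g * c := by
  ext x
  simp only [mem_cell, shape, Finset.mem_image, Finset.mem_filter]
  constructor
  · rintro ⟨hx, h⟩
    exact ⟨x * c⁻¹, ⟨mem_centers.1 h.1, by simpa using h⟩, by simp⟩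
  · rintro ⟨t, ⟨ht, h⟩, rfl⟩
    exact ⟨hc t ht, h⟩

/-- The distribution of the shape in a uniformly random order is translation invariant. -/
theorem card_shape_eq {G : Type*} [Group G] [DecidableEq G] (e : G → ℕ) {T W : Finset G}
    {c c' : G} (hc : ∀ t ∈ T, centers T (t * c) ⊆ W) (hc' : ∀ t ∈ T, centers T (t * c') ⊆ W)
    (S : Finset G) :
    (Finset.univ.filter fun σ : Equiv.Perm {x // x ∈ W} =>
      shape (permLabel e W σ) T c = S).card =
    (Finset.univ.filter fun σ : Equiv.Perm {x // x ∈ W} =>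
      shape (permLabel e W σ) T c' = S).card := by
  classical
  set E : Finset G := T.biUnion fun t => centers T (t * c)
  have hEW : E ⊆ W := Finset.biUnion_subset.2 hc
  have hEW' : ∀ w ∈ E, w * (c⁻¹ * c') ∈ W := by
    intro w hw
    obtain ⟨t, ht, hw⟩ := Finset.mem_biUnion.1 hw
    refine hc' t ht (mem_centers.2 ?_)
    simpa [mul_assoc] using mem_centers.1 hw
  let f : {w : {x // x ∈ W} // (w : G) ∈ E} →
      {w : {x // x ∈ W} // (w : G) * (c⁻¹ * c')⁻¹ ∈ E} :=
    fun w => ⟨⟨w.1.1 * (c⁻¹ * c'), hEW' _ w.2⟩, by simpa only [mul_inv_cancel_right] using w.2⟩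
  have hf : Function.Bijective f := by
    constructor
    · intro a b hab
      exact Subtype.ext (Subtype.ext (mul_right_cancel (congrArg (fun w => w.1.1) hab)))
    · rintro ⟨⟨w, hw⟩, hwE⟩
      exact ⟨⟨⟨w * (c⁻¹ * c')⁻¹, hEW hwE⟩, hwE⟩, by simp only [f, inv_mul_cancel_right]⟩
  let π : Equiv.Perm {x // x ∈ W} := (Equiv.ofBijective f hf).extendSubtype
  have hπ : ∀ w ∈ E, (Equiv.Perm.ofSubtype π : Equiv.Perm G) w = w * (c⁻¹ * c') := by
    intro w hw
    rw [Equiv.Perm.ofSubtype_apply_of_mem π (hEW hw)]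
    simp only [π]
    exact congrArg Subtype.val (Equiv.extendSubtype_apply_of_mem (Equiv.ofBijective f hf) ⟨w, hEW hw⟩ hw)
  refine Finset.card_equiv (Equiv.mulRight π⁻¹) fun σ => ?_
  simp only [Finset.mem_filter, Finset.mem_univ, true_and, Equiv.coe_mulRight]
  have hshape : shape (permLabel e W σ) T c = shape (permLabel e W (σ * π⁻¹)) T c' := by
    conv_lhs => rw [← inv_mul_cancel_right σ π]
    rw [permLabel_mul]
    refine Finset.filter_congr fun t ht => ?_
    rw [isFirst_comp_iff (Equiv.injective _)]
    have hsub : centers T (t * c) ⊆ E :=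
      Finset.subset_biUnion_of_mem (fun t => centers T (t * c)) ht
    have h1 : (centers T (t * c)).image (Equiv.Perm.ofSubtype π : Equiv.Perm G) =
        centers T (t * c') := by
      rw [Finset.image_congr (g := fun w => w * (c⁻¹ * c')) fun w hw => hπ w (hsub hw), centers,
        Finset.image_image, centers]
      congr 1
      ext s
      simp [mul_assoc]
    rw [h1, hπ c (hsub (mem_centers.2 (by simpa using ht)))]
    simp
  rw [hshape]

/-- The elements `c` with `T c ⊆ U`. -/
def interiorCenters {G : Type*} [Group G] [DecidableEq G] (T U : Finset G) : Finset G :=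
  (U.biUnion (centers T)).filter fun c => ∀ t ∈ T, t * c ∈ U

theorem mem_interiorCenters {G : Type*} [Group G] [DecidableEq G] {T U : Finset G}
    (hT : T.Nonempty) {c : G} : c ∈ interiorCenters T U ↔ ∀ t ∈ T, t * c ∈ U := by
  simp only [interiorCenters, Finset.mem_filter, Finset.mem_biUnion, and_iff_right_iff_imp]
  intro h
  obtain ⟨t, ht⟩ := hT
  exact ⟨t * c, h t ht, mem_centers.2 (by simpa using ht)⟩

section AlmostAdditive

variable {G : Type*} [Group G] [DecidableEq G] {X : Type*} [NormedAddCommGroup X]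

theorem norm_sub_sum_biUnion_le {G : Type*} [DecidableEq G] {F : Finset G → X} {b : Finset G → ℝ}
    (hFadd : ∀ (k : ℕ) (Q : Fin k → Finset G),
      (∀ i j, i ≠ j → Disjoint (Q i) (Q j)) →
      ‖F (Finset.univ.biUnion Q) - ∑ i, F (Q i)‖ ≤ ∑ i, b (Q i))
    {ι : Type*} (W : Finset ι) (Q : ι → Finset G)
    (hQ : ∀ i j, i ≠ j → Disjoint (Q i) (Q j)) :
    ‖F (W.biUnion Q) - ∑ i ∈ W, F (Q i)‖ ≤ ∑ i ∈ W, b (Q i) := by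
  let φ := W.equivFin.symm
  have h := hFadd W.card (fun i => Q (φ i)) fun i j hij => hQ _ _ fun h =>
    hij (φ.injective (Subtype.ext h))
  have h1 : Finset.univ.biUnion (fun i => Q (φ i)) = W.biUnion Q := by
    ext x
    simp only [Finset.mem_biUnion, Finset.mem_univ, true_and]
    constructor
    · rintro ⟨i, hi⟩
      exact ⟨φ i, (φ i).2, hi⟩
    · rintro ⟨i, hi, hx⟩
      exact ⟨φ.symm ⟨i, hi⟩, by simpa using hx⟩
  rw [h1, Equiv.sum_comp φ (fun i => F (Q i)), Equiv.sum_comp φ (fun i => b (Q i)),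
    Finset.sum_coe_sort W (fun i => F (Q i)), Finset.sum_coe_sort W (fun i => b (Q i))] at h
  exact h

theorem exists_norm_le_mul_card {A : Type*} [Finite A] (C : G → A) {F : Finset G → X}
    {b : Finset G → ℝ} {D : ℝ} (hbD : ∀ Q : Finset G, b Q ≤ D * (Q.card : ℝ))
    (hFadd : ∀ (k : ℕ) (Q : Fin k → Finset G),
      (∀ i j, i ≠ j → Disjoint (Q i) (Q j)) →
      ‖F (Finset.univ.biUnion Q) - ∑ i, F (Q i)‖ ≤ ∑ i, b (Q i))
    (hFinv : ∀ (Q : Finset G) (x : G), (∀ g ∈ Q, C (g * x) = C g) →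
      F (Q.image (fun g => g * x)) = F Q) :
    ∃ L : ℝ, 0 ≤ L ∧ ∀ Q, ‖F Q‖ ≤ L * (Q.card : ℝ) := by
  have hsingle : ∀ g h : G, C g = C h → F {g} = F {h} := by
    intro g h hgh
    have := hFinv {g} (g⁻¹ * h) (by simp [hgh])
    simpa using this.symm
  have hfin : (Set.range fun g : G => ‖F {g}‖).Finite := by
    refine (Set.finite_range fun a : A => ‖F {Function.invFun C a}‖).subset ?_
    rintro _ ⟨g, rfl⟩
    exact ⟨C g, by
      dsimp only
      rw [hsingle _ g (Function.invFun_eq ⟨g, rfl⟩)]⟩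
  obtain ⟨L, hL⟩ := hfin.bddAbove
  have hL' : ∀ g, ‖F {g}‖ ≤ L := fun g => hL ⟨g, rfl⟩
  have hbound : ∀ Q, ‖F Q‖ ≤ (L + D) * (Q.card : ℝ) := by
    intro Q
    have h := norm_sub_sum_biUnion_le hFadd Q (fun g => {g}) fun i j hij => by simpa using hij
    rw [Finset.biUnion_singleton_eq_self] at h
    have h1 : ∑ i ∈ Q, b {i} ≤ Q.card * D := by
      rw [← nsmul_eq_mul]
      exact Finset.sum_le_card_nsmul _ _ _ fun i _ => by simpa using hbD {i}
    have h2 : ‖∑ g ∈ Q, F {g}‖ ≤ Q.card * L := by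
      rw [← nsmul_eq_mul]
      exact norm_sum_le_of_le _ (fun i _ => hL' i) |>.trans (by simp)
    have h3 := norm_le_norm_sub_add (F Q) (∑ g ∈ Q, F {g})
    linarith
  refine ⟨|L + D|, abs_nonneg _, fun Q => (hbound Q).trans ?_⟩
  gcongr
  exact le_abs_self _

open Classical in
theorem norm_sub_sum_cell_le {F : Finset G → X} {b : Finset G → ℝ} {ε M : ℝ} (hM : 0 ≤ M)
    {K : Finset G} (hb : ∀ Q : Finset G, b Q ≤ ε * Q.card + M * ∑ k ∈ K, (cutCard k Q : ℝ))
    (hFadd : ∀ (k : ℕ) (Q : Fin k → Finset G),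
      (∀ i j, i ≠ j → Disjoint (Q i) (Q j)) →
      ‖F (Finset.univ.biUnion Q) - ∑ i, F (Q i)‖ ≤ ∑ i, b (Q i))
    {l : G → ℕ} (hl : Function.Injective l) {T U W : Finset G} (hT : T.Nonempty)
    (hW : ∀ x ∈ U, centers T x ⊆ W) :
    ‖F U - ∑ c ∈ W, F (cell l T U c)‖ ≤ ε * U.card + M * ∑ k ∈ K, ((cutCard k U : ℝ) +
      (U.filter fun x => ¬ ∃ c, IsFirst l (centers T x) c ∧
        IsFirst l (centers T (k * x)) c).card) := by
  have h := norm_sub_sum_biUnion_le hFadd W (cell l T U) fun c c' => disjoint_cell hl T U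
  rw [biUnion_cell l hT hW] at h
  refine h.trans ((Finset.sum_le_sum fun c _ => hb _).trans ?_)
  rw [Finset.sum_add_distrib, ← Finset.mul_sum, ← Finset.mul_sum, Finset.sum_comm]
  have hcard : ∑ c ∈ W, ((cell l T U c).card : ℝ) = U.card := by
    rw [← Nat.cast_sum, ← Finset.card_biUnion fun c _ c' _ h => disjoint_cell hl T U h,
      biUnion_cell l hT hW]
  rw [hcard]
  gcongr with k hk
  exact_mod_cast sum_cutCard_cell_le hl T U W k

end AlmostAdditive

open Classical in
theorem sum_card_not_common_isFirst_mul_card_le {G : Type*} [Group G] [DecidableEq G]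
    {e : G → ℕ} (he : Function.Injective e) {T U W : Finset G} (k : G)
    (hW : ∀ x ∈ U, centers T x ⊆ W) (hW' : ∀ x ∈ U, centers T (k * x) ⊆ W) :
    (∑ σ : Equiv.Perm {x // x ∈ W}, (U.filter fun x =>
      ¬ ∃ c, IsFirst (permLabel e W σ) (centers T x) c ∧
        IsFirst (permLabel e W σ) (centers T (k * x)) c).card) * T.card ≤
      Fintype.card (Equiv.Perm {x // x ∈ W}) * (U.card * (2 * cutCard k T)) := by
  simp_rw [Finset.card_filter]
  rw [Finset.sum_comm, Finset.sum_mul]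
  simp_rw [← Finset.card_filter]
  calc _ ≤ ∑ x ∈ U, Fintype.card (Equiv.Perm {x // x ∈ W}) * (2 * cutCard k T) := by
        refine Finset.sum_le_sum fun x hx => ?_
        have := card_not_common_isFirst_mul_card_le he (hW x hx) (hW' x hx)
          ((card_centers T x).trans (card_centers T (k * x)).symm)
        rwa [card_centers, card_centers_sdiff] at this
    _ = _ := by
        rw [Finset.sum_const, smul_eq_mul]
        ring

/-- An almost additive function of `U` is approximated by a weighted sum of its values on the
translates contained in `U` of the subsets of `T`, with weights not depending on `U`. -/
theorem exists_weights_norm_sub_le {G : Type*} [Group G] [Countable G] [DecidableEq G]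
    {X : Type*} [NormedAddCommGroup X] [NormedSpace ℝ X] {F : Finset G → X}
    {b : Finset G → ℝ} {ε M L : ℝ} (hM : 0 ≤ M) (hL0 : 0 ≤ L) {K : Finset G}
    (hb : ∀ Q : Finset G, b Q ≤ ε * Q.card + M * ∑ k ∈ K, (cutCard k Q : ℝ))
    (hL : ∀ Q, ‖F Q‖ ≤ L * (Q.card : ℝ))
    (hFadd : ∀ (k : ℕ) (Q : Fin k → Finset G),
      (∀ i j, i ≠ j → Disjoint (Q i) (Q j)) →
      ‖F (Finset.univ.biUnion Q) - ∑ i, F (Q i)‖ ≤ ∑ i, b (Q i))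
    {T : Finset G} (hT : T.Nonempty) (W : Finset G) :
    ∃ q : Finset G → ℝ, (∀ S, 0 ≤ q S ∧ q S ≤ 1) ∧ ∀ U : Finset G,
      (∀ x ∈ U, centers T x ⊆ W) → (∀ k ∈ K, ∀ x ∈ U, centers T (k * x) ⊆ W) →
      ‖F U - ∑ S ∈ T.powerset, q S • ∑ c ∈ interiorCenters T U, F (S.image fun g => g * c)‖ ≤
        ε * U.card + M * ∑ k ∈ K, ((cutCard k U : ℝ) +
          U.card * (2 * ((cutCard k T : ℝ) / T.card))) +
        L * ∑ t ∈ T, ∑ t' ∈ T, (cutCard (t' * t⁻¹) U : ℝ) := by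
  classical
  obtain ⟨e, he⟩ := exists_injective_nat G
  set Ω := Equiv.Perm {x // x ∈ W}
  set N : ℝ := (Fintype.card Ω : ℝ) with hN
  have hN0 : 0 < N := Nat.cast_pos.2 Fintype.card_pos
  have hT0 : (0 : ℝ) < T.card := by exact_mod_cast hT.card_pos
  obtain ⟨n, hn, hn'⟩ : ∃ n : Finset G → ℕ, (∀ S, n S ≤ Fintype.card Ω) ∧
      ∀ c, (∀ t ∈ T, centers T (t * c) ⊆ W) → ∀ S,
        (Finset.univ.filter fun σ : Ω => shape (permLabel e W σ) T c = S).card = n S := by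
    by_cases h : ∃ c, ∀ t ∈ T, centers T (t * c) ⊆ W
    · obtain ⟨c₀, hc₀⟩ := h
      exact ⟨_, fun S => Finset.card_le_univ _, fun c hc S => card_shape_eq e hc hc₀ S⟩
    · exact ⟨0, fun S => Nat.zero_le _, fun c hc => (h ⟨c, hc⟩).elim⟩
  refine ⟨fun S => n S / N, fun S => ⟨by positivity, ?_⟩, fun U hU hKU => ?_⟩
  · rw [div_le_one hN0]
    exact Nat.cast_le.2 (hn S)
  have hI : (W.filter fun c => ∀ t ∈ T, t * c ∈ U) = interiorCenters T U := by
    ext c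
    rw [mem_interiorCenters hT, Finset.mem_filter, and_iff_right_iff_imp]
    intro h
    obtain ⟨t, ht⟩ := hT
    exact hU _ (h t ht) (mem_centers.2 (by simpa using ht))
  have hmain : ∑ σ : Ω, ∑ c ∈ interiorCenters T U, F (cell (permLabel e W σ) T U c) =
      N • ∑ S ∈ T.powerset, ((n S : ℝ) / N) •
        ∑ c ∈ interiorCenters T U, F (S.image fun g => g * c) := by
    simp_rw [Finset.smul_sum]
    rw [Finset.sum_comm, Finset.sum_comm (s := T.powerset)]
    refine Finset.sum_congr rfl fun c hc => ?_
    have hc' := (mem_interiorCenters hT).1 hc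
    simp_rw [cell_eq_image_shape _ hc']
    rw [← Finset.sum_fiberwise_of_maps_to (t := T.powerset)
      (g := fun σ : Ω => shape (permLabel e W σ) T c)
      fun σ _ => Finset.mem_powerset.2 (Finset.filter_subset _ _)]
    refine Finset.sum_congr rfl fun S _ => ?_
    rw [Finset.sum_congr rfl (g := fun _ => F (S.image fun g => g * c)) fun σ hσ => by
      rw [(Finset.mem_filter.1 hσ).2], Finset.sum_const, hn' c fun t ht => hU _ (hc' t ht),
      smul_smul, mul_div_cancel₀ _ hN0.ne', Nat.cast_smul_eq_nsmul]
  have hrest : ∀ σ : Ω, ‖∑ c ∈ W with ¬ ∀ t ∈ T, t * c ∈ U,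
      F (cell (permLabel e W σ) T U c)‖ ≤
      L * ∑ t ∈ T, ∑ t' ∈ T, (cutCard (t' * t⁻¹) U : ℝ) := by
    intro σ
    refine (norm_sum_le_of_le _ fun c _ => hL _).trans ?_
    rw [← Finset.mul_sum]
    gcongr
    exact_mod_cast sum_card_cell_le_sum_cutCard (permLabel_injective he W σ) T U W
  have hσ : ∀ σ : Ω, ‖F U - ∑ c ∈ interiorCenters T U, F (cell (permLabel e W σ) T U c)‖ ≤
      ε * U.card + M * ∑ k ∈ K, ((cutCard k U : ℝ) + (U.filter fun x =>
        ¬ ∃ c, IsFirst (permLabel e W σ) (centers T x) c ∧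
        IsFirst (permLabel e W σ) (centers T (k * x)) c).card) +
        L * ∑ t ∈ T, ∑ t' ∈ T, (cutCard (t' * t⁻¹) U : ℝ) := by
    intro σ
    have h := norm_sub_sum_cell_le hM hb hFadd (permLabel_injective he W σ) hT hU
    rw [← Finset.sum_filter_add_sum_filter_not W fun c => ∀ t ∈ T, t * c ∈ U, hI,
      ← sub_sub] at h
    have h' := norm_le_norm_sub_add
      (F U - ∑ c ∈ interiorCenters T U, F (cell (permLabel e W σ) T U c))
      (∑ c ∈ W with ¬ ∀ t ∈ T, t * c ∈ U, F (cell (permLabel e W σ) T U c))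
    linarith [hrest σ]
  have hbad : ∀ k ∈ K, ∑ σ : Ω, ((U.filter fun x =>
        ¬ ∃ c, IsFirst (permLabel e W σ) (centers T x) c ∧
        IsFirst (permLabel e W σ) (centers T (k * x)) c).card : ℝ) ≤
      N * (U.card * (2 * ((cutCard k T : ℝ) / T.card))) := by
    intro k hk
    have h := sum_card_not_common_isFirst_mul_card_le he k hU (hKU k hk)
    have h' : (∑ σ : Ω, ((U.filter fun x =>
        ¬ ∃ c, IsFirst (permLabel e W σ) (centers T x) c ∧
        IsFirst (permLabel e W σ) (centers T (k * x)) c).card : ℝ)) * T.card ≤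
        N * (U.card * (2 * (cutCard k T : ℝ))) := by
      rw [hN]
      exact_mod_cast h
    rw [← le_div_iff₀ hT0] at h'
    exact h'.trans_eq (by ring)
  have hsum := norm_sum_le_of_le Finset.univ fun σ _ => hσ σ
  rw [Finset.sum_sub_distrib, hmain, Finset.sum_const, Finset.card_univ,
    ← Nat.cast_smul_eq_nsmul ℝ, ← hN, ← smul_sub, norm_smul, Real.norm_of_nonneg hN0.le,
    Finset.sum_add_distrib, Finset.sum_add_distrib, Finset.sum_const, Finset.sum_const,
    Finset.card_univ, nsmul_eq_mul, nsmul_eq_mul, ← hN, ← Finset.mul_sum, Finset.sum_comm]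
    at hsum
  refine le_of_mul_le_mul_left (hsum.trans ?_) hN0
  rw [mul_add, mul_add, mul_left_comm N M, Finset.mul_sum (a := N)]
  gcongr with k hk
  rw [Finset.sum_add_distrib, Finset.sum_const, Finset.card_univ, nsmul_eq_mul, ← hN, mul_add]
  gcongr
  exact hbad k hk

/-- The averages of an invariant function over the translates of a fixed subset of `T` converge
when the pattern frequencies exist. -/
theorem exists_tendsto_average_translates {G : Type*} [Group G] [DecidableEq G]
    {X : Type*} [NormedAddCommGroup X] [NormedSpace ℝ X] {A : Type*} [Fintype A] (C : G → A)
    (U : ℕ → Finset G)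
    (hfreq : ∀ (Dp : Finset G) (P : G → A), ∃ ν : ℝ,
      Tendsto (fun j => (patternCount C Dp P (U j) : ℝ) / ((U j).card : ℝ)) atTop (nhds ν))
    {F : Finset G → X}
    (hFinv : ∀ (Q : Finset G) (x : G), (∀ g ∈ Q, C (g * x) = C g) →
      F (Q.image (fun g => g * x)) = F Q)
    {T S : Finset G} (hT : T.Nonempty) (hS : S ⊆ T) :
    ∃ y : X, Tendsto (fun j => ((U j).card : ℝ)⁻¹ • ∑ c ∈ interiorCenters T (U j),
      F (S.image fun g => g * c)) atTop (nhds y) := by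
  classical
  let pat : G → {t // t ∈ T} → A := fun c t => C (t * c)
  let ext : ({t // t ∈ T} → A) → G → A := fun P g => if h : g ∈ T then P ⟨g, h⟩ else C 1
  have hinv : ∀ c c', pat c = pat c' →
      F (S.image fun g => g * c) = F (S.image fun g => g * c') := by
    intro c c' h
    rw [← hFinv (S.image fun g => g * c) (c⁻¹ * c'), Finset.image_image]
    · congr 2
      ext g
      simp
    · intro g hg
      obtain ⟨s, hs, rfl⟩ := Finset.mem_image.1 hg
      simpa [mul_assoc] using (congrFun h ⟨s, hS hs⟩).symm
  have hcount : ∀ P Q, ((interiorCenters T Q).filter fun c => pat c = P).card =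
      patternCount C T (ext P) Q := by
    intro P Q
    rw [patternCount, ← Set.ncard_coe_finset]
    congr 1
    ext c
    simp only [Finset.coe_filter, mem_interiorCenters hT, Set.mem_ofPred_eq, pat, ext,
      funext_iff, Subtype.forall]
    refine and_congr_right fun _ => forall₂_congr fun t ht => ?_
    rw [dif_pos ht]
  let f : ({t // t ∈ T} → A) → X := fun P => F (S.image fun g => g * Function.invFun pat P)
  have hsum : ∀ Q, ∑ c ∈ interiorCenters T Q, F (S.image fun g => g * c) =
      ∑ P, (patternCount C T (ext P) Q : ℝ) • f P := by
    intro Q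
    rw [← Finset.sum_fiberwise (interiorCenters T Q) pat]
    refine Finset.sum_congr rfl fun P _ => ?_
    rw [Finset.sum_congr rfl (g := fun _ => f P), Finset.sum_const, hcount,
      Nat.cast_smul_eq_nsmul]
    intro c hc
    have hcP := (Finset.mem_filter.1 hc).2
    exact hinv _ _ (hcP.trans (Function.invFun_eq ⟨c, hcP⟩).symm)
  choose ν hν using fun P => hfreq T (ext P)
  refine ⟨∑ P, ν P • f P, ?_⟩
  have := tendsto_finsetSum Finset.univ fun P _ => (hν P).smul_const (f P)
  refine this.congr fun j => ?_
  rw [hsum, Finset.smul_sum]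
  refine Finset.sum_congr rfl fun P _ => ?_
  rw [smul_smul, inv_mul_eq_div]

/-- The almost additive ergodic theorem (Theorem 5.6 (i)): for a countable amenable group,
a coloring whose pattern frequencies exist along the Følner sequence `(U_j)`, and an almost
additive 𝒞-invariant Banach space valued function `F`, the averages `F(U_j)/|U_j|` converge. -/
theorem stmt_12 {G : Type*} [Group G] [Countable G] [DecidableEq G]
    {X : Type*} [NormedAddCommGroup X] [NormedSpace ℝ X] [CompleteSpace X]
    {A : Type*} [Fintype A] (C : G → A)
    (U : ℕ → Finset G) (hU : IsFolnerF U)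
    -- the frequencies of all patterns exist along (U_j):
    (hfreq : ∀ (Dp : Finset G) (P : G → A), ∃ ν : ℝ,
      Tendsto (fun j => (patternCount C Dp P (U j) : ℝ) / ((U j).card : ℝ)) atTop (nhds ν))
    (F : Finset G → X) (b : Finset G → ℝ) (D : ℝ) (hD : 0 < D)
    -- b is a boundary term:
    (hb0 : ∀ Q : Finset G, 0 ≤ b Q)
    (hbinv : ∀ (Q : Finset G) (x : G), b (Q.image (fun g => g * x)) = b Q)
    (hbfol : ∀ V : ℕ → Finset G, IsFolnerF V →
      Tendsto (fun j => b (V j) / ((V j).card : ℝ)) atTop (nhds 0))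
    (hbD : ∀ Q : Finset G, b Q ≤ D * (Q.card : ℝ))
    (hbsub : ∀ Q Q' : Finset G,
      b (Q ∩ Q') ≤ b Q + b Q' ∧ b (Q ∪ Q') ≤ b Q + b Q' ∧ b (Q \ Q') ≤ b Q + b Q')
    -- F is almost additive with boundary term b:
    (hFadd : ∀ (k : ℕ) (Q : Fin k → Finset G),
      (∀ i j, i ≠ j → Disjoint (Q i) (Q j)) →
      ‖F (Finset.univ.biUnion Q) - ∑ i, F (Q i)‖ ≤ ∑ i, b (Q i))
    -- F is 𝒞-invariant:
    (hFinv : ∀ (Q : Finset G) (x : G), (∀ g ∈ Q, C (g * x) = C g) →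
      F (Q.image (fun g => g * x)) = F Q) :
    ∃ Fbar : X,
      Tendsto (fun j => ‖Fbar - (((U j).card : ℝ))⁻¹ • F (U j)‖) atTop (nhds 0) := by
  obtain ⟨L, hL0, hL⟩ := exists_norm_le_mul_card C hbD hFadd hFinv
  have hcauchy : CauchySeq fun j => ((U j).card : ℝ)⁻¹ • F (U j) := by
    rw [Metric.cauchySeq_iff']
    intro ε hε
    set δ := ε / 6 with hδ
    have hδ0 : 0 < δ := by positivity
    obtain ⟨K, M, hM, hb⟩ := exists_le_add_sum_cutCard b D hbfol hbD hδ0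
    obtain ⟨m, hm⟩ : ∃ m, M * ∑ k ∈ K, 2 * ((cutCard k (U m) : ℝ) / (U m).card) < δ := by
      have h : Tendsto (fun m => M * ∑ k ∈ K, 2 * ((cutCard k (U m) : ℝ) / (U m).card)) atTop
          (nhds 0) := by
        simpa using (tendsto_finsetSum K fun k _ =>
          (hU.tendsto_cutCard k).const_mul 2).const_mul M
      exact (h.eventually (gt_mem_nhds hδ0)).exists
    set T := U m
    have hT : T.Nonempty := hU.1 m
    choose! y hy using fun S (hS : S ⊆ T) =>
      exists_tendsto_average_translates C U hfreq hFinv hT hS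
    have herr : ∀ᶠ j in atTop, δ + M * ∑ k ∈ K, ((cutCard k (U j) : ℝ) / (U j).card +
        2 * ((cutCard k T : ℝ) / T.card)) +
        L * ∑ t ∈ T, ∑ t' ∈ T, (cutCard (t' * t⁻¹) (U j) : ℝ) / (U j).card < 2 * δ := by
      have h : Tendsto (fun j => δ + M * ∑ k ∈ K, ((cutCard k (U j) : ℝ) / (U j).card +
          2 * ((cutCard k T : ℝ) / T.card)) +
          L * ∑ t ∈ T, ∑ t' ∈ T, (cutCard (t' * t⁻¹) (U j) : ℝ) / (U j).card) atTop
          (nhds (δ + M * ∑ k ∈ K, (0 + 2 * ((cutCard k T : ℝ) / T.card)) +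
            L * ∑ t ∈ T, ∑ t' ∈ T, (0 : ℝ))) := by
        refine ((tendsto_finsetSum K fun k _ =>
          (hU.tendsto_cutCard k).add_const _).const_mul M |>.const_add δ).add ?_
        exact (tendsto_finsetSum T fun t _ => tendsto_finsetSum T fun t' _ =>
          hU.tendsto_cutCard (t' * t⁻¹)).const_mul L
      refine h.eventually (gt_mem_nhds ?_)
      simp only [zero_add, Finset.sum_const_zero, mul_zero, add_zero]
      linarith
    have hconv : ∀ᶠ j in atTop, ∑ S ∈ T.powerset, ‖((U j).card : ℝ)⁻¹ •
        ∑ c ∈ interiorCenters T (U j), F (S.image fun g => g * c) - y S‖ < δ := by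
      have h := tendsto_finsetSum T.powerset fun S hS =>
        tendsto_iff_norm_sub_tendsto_zero.1 (hy S (Finset.mem_powerset.1 hS))
      rw [Finset.sum_const_zero] at h
      exact h.eventually (gt_mem_nhds hδ0)
    obtain ⟨N, hN⟩ := eventually_atTop.1 (herr.and hconv)
    refine ⟨N, fun n hn => ?_⟩
    set V := U n ∪ U N
    set W := V.biUnion (centers T) ∪ K.biUnion fun k => V.biUnion fun x => centers T (k * x)
    have hW : ∀ x ∈ V, centers T x ⊆ W := fun x hx =>
      (Finset.subset_biUnion_of_mem (centers T) hx).trans Finset.subset_union_left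
    have hKW : ∀ k ∈ K, ∀ x ∈ V, centers T (k * x) ⊆ W := fun k hk x hx =>
      ((Finset.subset_biUnion_of_mem (fun x => centers T (k * x)) hx).trans
        (Finset.subset_biUnion_of_mem (fun k => V.biUnion fun x => centers T (k * x))
          hk)).trans Finset.subset_union_right
    obtain ⟨q, hq, hqU⟩ := exists_weights_norm_sub_le hM hL0 hb hL hFadd hT W
    have hclose : ∀ j, N ≤ j → U j ⊆ V →
        ‖((U j).card : ℝ)⁻¹ • F (U j) - ∑ S ∈ T.powerset, q S • y S‖ < 3 * δ := by
      intro j hj hjV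
      obtain ⟨h1, h2⟩ := hN j hj
      have hpos : (0 : ℝ) < (U j).card := by exact_mod_cast (hU.1 j).card_pos
      have h3 := hqU (U j) (fun x hx => hW x (hjV hx)) fun k hk x hx => hKW k hk x (hjV hx)
      have h4 : ‖((U j).card : ℝ)⁻¹ • F (U j) - ∑ S ∈ T.powerset, q S • ((U j).card : ℝ)⁻¹ •
          ∑ c ∈ interiorCenters T (U j), F (S.image fun g => g * c)‖ < 2 * δ := by
        refine lt_of_le_of_lt ?_ h1
        simp_rw [smul_comm (q _)]
        rw [← Finset.smul_sum, ← smul_sub, norm_smul, norm_inv, Real.norm_of_nonneg hpos.le,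
          inv_mul_le_iff₀ hpos]
        refine h3.trans_eq ?_
        simp_rw [← Finset.sum_div, Finset.sum_add_distrib, ← Finset.sum_div, ← Finset.mul_sum]
        field_simp
      have h5 : ‖∑ S ∈ T.powerset, q S • ((U j).card : ℝ)⁻¹ •
          ∑ c ∈ interiorCenters T (U j), F (S.image fun g => g * c) -
          ∑ S ∈ T.powerset, q S • y S‖ < δ := by
        refine lt_of_le_of_lt ?_ h2
        rw [← Finset.sum_sub_distrib]
        refine norm_sum_le_of_le _ fun S _ => ?_
        rw [← smul_sub, norm_smul, Real.norm_of_nonneg (hq S).1]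
        exact mul_le_of_le_one_left (norm_nonneg _) (hq S).2
      have := norm_sub_le_norm_sub_add_norm_sub (((U j).card : ℝ)⁻¹ • F (U j))
        (∑ S ∈ T.powerset, q S • ((U j).card : ℝ)⁻¹ •
          ∑ c ∈ interiorCenters T (U j), F (S.image fun g => g * c))
        (∑ S ∈ T.powerset, q S • y S)
      linarith
    have hn' := hclose n hn Finset.subset_union_left
    have hN' := hclose N le_rfl Finset.subset_union_right
    rw [← dist_eq_norm] at hn' hN'
    have := dist_triangle_right (((U n).card : ℝ)⁻¹ • F (U n)) (((U N).card : ℝ)⁻¹ • F (U N))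
      (∑ S ∈ T.powerset, q S • y S)
    linarith
  obtain ⟨Fbar, hF⟩ := cauchySeq_tendsto_of_complete hcauchy
  refine ⟨Fbar, ?_⟩
  simp_rw [norm_sub_rev Fbar]
  exact tendsto_iff_norm_sub_tendsto_zero.1 hF
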